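/- For every integer m ≥ 1 there exists a constant C > 0 (depending only on m) such that for every n, every m-intersecting family of n closed Jordan curves in general position in the plane has at most C · n^(2 − 1/(3m+15)) touching pairs. -/

import Mathlib

noncomputable section

abbrev Plane : Type := EuclideanSpace ℝ (Fin 2)

/-- A closed Jordan curve: a subset of the plane homeomorphic to the unit circle. -/
def IsJordanCurve (γ : Set Plane) : Prop :=
  Nonempty (γ ≃ₜ Metric.sphere (0 : Plane) 1)

/-- A Jordan arc: a subset of the plane homeomorphic to the closed unit interval. -/
def IsJordanArc (γ : Set Plane) : Prop :=
  Nonempty (γ ≃ₜ unitInterval)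

/-- General position: any two distinct members intersect in a finite set, and no point
of the plane lies on three distinct members. -/
def GenPos {n : ℕ} (γ : Fin n → Set Plane) : Prop :=
  (∀ i j : Fin n, i ≠ j → (γ i ∩ γ j).Finite) ∧
  (∀ p : Plane, ∀ i j k : Fin n, p ∈ γ i → p ∈ γ j → p ∈ γ k → i = j ∨ i = k ∨ j = k)

/-- `m`-intersecting: any two distinct members intersect in at most `m` points. -/
def MIntersecting {n : ℕ} (m : ℕ) (γ : Fin n → Set Plane) : Prop :=
  ∀ i j : Fin n, i ≠ j → (γ i ∩ γ j).ncard ≤ m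

/-- Two curves touch if their intersection is a singleton. -/
def Touches (a b : Set Plane) : Prop := ∃ x, a ∩ b = {x}

/-- The number of touching pairs of the family. -/
def touchingPairs {n : ℕ} (γ : Fin n → Set Plane) : ℕ :=
  {p : Fin n × Fin n | p.1 < p.2 ∧ Touches (γ p.1) (γ p.2)}.ncard

/-- The set of intersection points of the family: points lying on at least two
distinct members. -/
def interPoints {n : ℕ} (γ : Fin n → Set Plane) : Set Plane :=
  {x : Plane | ∃ i j : Fin n, i ≠ j ∧ x ∈ γ i ∧ x ∈ γ j}

theorem lift_exp {A : Type*} [TopologicalSpace A] [SimplyConnectedSpace A]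
    [LocallyPathConnectedSpace A] [Nonempty A] (f : A → ℂ) (hf : Continuous f)
    (h0 : ∀ a, f a ≠ 0) : ∃ L : A → ℂ, Continuous L ∧ ∀ a, Complex.exp (L a) = f a := by
  obtain ⟨a₀⟩ := ‹Nonempty A›
  obtain ⟨F, ⟨-, hF⟩, -⟩ := Complex.isCoveringMapOn_exp.existsUnique_continuousMap_lifts
    ⟨f, hf⟩ (a₀ := a₀) (e₀ := Complex.log (f a₀)) (Complex.exp_log (h0 a₀)) (fun a => h0 a)
  exact ⟨F, F.continuous, fun a => congrFun hF a⟩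

theorem lift_unique (L L' : ℝ → ℂ) (hL : Continuous L) (hL' : Continuous L') (c : ℂ)
    (h : ∀ x, Complex.exp (L x) = c * Complex.exp (L' x)) : L 1 - L 0 = L' 1 - L' 0 := by
  have key := Complex.isCoveringMap_exp.const_of_comp (A := ℝ) (g := fun x => L x - L' x)
    (by fun_prop) (by
      intro a a'
      apply Subtype.ext
      simp [Complex.exp_sub, h]) 1 0
  linear_combination key

def sg (u w : Fin 5) : ℤ := if w < u then 1 else -1

theorem K5_core (p : Fin 5 → ℂ) (G : Fin 5 → Fin 5 → ℝ → ℂ)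
    (hc : ∀ i j, i < j → Continuous (G i j))
    (h0 : ∀ i j, i < j → G i j 0 = p i) (h1 : ∀ i j, i < j → G i j 1 = p j)
    (hd : ∀ i j k l, i < j → k < l → i ≠ k → i ≠ l → j ≠ k → j ≠ l →
      ∀ x y, G i j x ≠ G k l y) : False := by
  -- vertex not on edge
  have hex : ∀ k i j : Fin 5, ∃ l : Fin 5, l ≠ k ∧ l ≠ i ∧ l ≠ j := by decide
  have hv : ∀ k i j, i < j → k ≠ i → k ≠ j → ∀ x, G i j x - p k ≠ 0 := by
    intro k i j hij hki hkj x
    obtain ⟨l, hlk, hli, hlj⟩ := hex k i j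
    rw [sub_ne_zero]
    rcases lt_or_gt_of_ne hlk with h | h
    · rw [← h1 l k h]; exact hd i j l k hij h hli.symm hki.symm hlj.symm hkj.symm x 1
    · rw [← h0 k l h]; exact hd i j k l hij h hki.symm hli.symm hkj.symm hlj.symm x 0
  have hp : ∀ k u, k ≠ u → p u - p k ≠ 0 := by
    intro k u hku
    obtain ⟨l, hlk, hlu, -⟩ := hex k u u
    rcases lt_or_gt_of_ne hlu with h | h
    · rw [← h1 l u h]; exact hv k l u h hlk.symm hku 1
    · rw [← h0 u l h]; exact hv k u l h hku hlk.symm 0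
  let φ : Fin 5 → Fin 5 → ℂ := fun k u =>
    if k < u then Complex.log (p u - p k) else Complex.log (p k - p u) + Real.pi * Complex.I
  have hφ : ∀ k u, k ≠ u → Complex.exp (φ k u) = p u - p k := by
    intro k u hku
    simp only [φ]
    split_ifs with h
    · exact Complex.exp_log (hp k u hku)
    · rw [Complex.exp_add, Complex.exp_log (hp u k hku.symm), Complex.exp_pi_mul_I]; ring
  have hsg : ∀ k u, k ≠ u → φ k u - φ u k = Real.pi * Complex.I * (sg k u : ℂ) := by
    intro k u hku
    rcases lt_or_gt_of_ne hku with h | h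
    · simp [φ, sg, h, h.not_gt]
    · simp [φ, sg, h, h.not_gt]
  have hΔ : ∀ k i j, ∃ (L : ℝ → ℂ) (N : ℤ), i < j → k ≠ i → k ≠ j →
      Continuous L ∧ (∀ x, Complex.exp (L x) = G i j x - p k) ∧
      L 1 - L 0 = φ k j - φ k i + N * (2 * Real.pi * Complex.I) := by
    intro k i j
    by_cases h : i < j ∧ k ≠ i ∧ k ≠ j
    · obtain ⟨hij, hki, hkj⟩ := h
      obtain ⟨L, hLc, hL⟩ := lift_exp (fun x => G i j x - p k)
        ((hc i j hij).sub continuous_const) (hv k i j hij hki hkj)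
      have e1 : Complex.exp (L 1) = Complex.exp (φ k j) := by rw [hL, h1 i j hij, hφ k j hkj]
      have e0 : Complex.exp (L 0) = Complex.exp (φ k i) := by rw [hL, h0 i j hij, hφ k i hki]
      obtain ⟨n1, hn1⟩ := Complex.exp_eq_exp_iff_exists_int.1 e1
      obtain ⟨n0, hn0⟩ := Complex.exp_eq_exp_iff_exists_int.1 e0
      refine ⟨L, n1 - n0, fun _ _ _ => ⟨hLc, hL, ?_⟩⟩
      rw [hn1, hn0]; push_cast; ring
    · exact ⟨0, 0, fun a b c => absurd ⟨a, b, c⟩ h⟩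
  choose Lf N hLN using hΔ
  have main : ∀ i j k l, i < j → k < l → i ≠ k → i ≠ l → j ≠ k → j ≠ l →
      sg k j + sg i k + sg j l + sg l i + 2 * (N k i j + N j k l - N i k l - N l i j) = 0 := by
    intro i j k l hij hkl hik hil hjk hjl
    obtain ⟨S, hSc, hS⟩ := lift_exp (A := ℝ × ℝ) (fun z => G i j z.1 - G k l z.2)
      (((hc i j hij).comp continuous_fst).sub ((hc k l hkl).comp continuous_snd))
      (fun z => sub_ne_zero.2 (hd i j k l hij hkl hik hil hjk hjl _ _))
    obtain ⟨c1, e1, d1⟩ := hLN k i j hij hik.symm hjk.symm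
    obtain ⟨c2, e2, d2⟩ := hLN l i j hij hil.symm hjl.symm
    obtain ⟨c3, e3, d3⟩ := hLN i k l hkl hik hil
    obtain ⟨c4, e4, d4⟩ := hLN j k l hkl hjk hjl
    have f1 := lift_unique (fun x => S (x, 0)) (Lf k i j) (by fun_prop) c1 1 (by
      intro x; simp only [hS, e1, h0 k l hkl]; ring)
    have f2 := lift_unique (fun x => S (x, 1)) (Lf l i j) (by fun_prop) c2 1 (by
      intro x; simp only [hS, e2, h1 k l hkl]; ring)
    have f3 := lift_unique (fun x => S (0, x)) (Lf i k l) (by fun_prop) c3 (-1) (by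
      intro x; simp only [hS, e3, h0 i j hij]; ring)
    have f4 := lift_unique (fun x => S (1, x)) (Lf j k l) (by fun_prop) c4 (-1) (by
      intro x; simp only [hS, e4, h1 i j hij]; ring)
    have s1 := hsg k j hjk.symm
    have s2 := hsg i k hik
    have s3 := hsg j l hjl
    have s4 := hsg l i hil.symm
    have hpi : (Real.pi : ℂ) * Complex.I ≠ 0 := by
      simp [Real.pi_ne_zero]
    have : (Real.pi : ℂ) * Complex.I * ((sg k j + sg i k + sg j l + sg l i
        + 2 * (N k i j + N j k l - N i k l - N l i j) : ℤ) : ℂ) = 0 := by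
      push_cast
      linear_combination f3 + f2 - f1 - f4 - s1 - s2 - s3 - s4 - d1 - d4 + d3 + d2
    have := (mul_eq_zero.1 this).resolve_left hpi
    exact_mod_cast this
  have m1 := main 0 1 2 3 (by decide) (by decide) (by decide) (by decide) (by decide) (by decide)
  have m2 := main 0 2 1 3 (by decide) (by decide) (by decide) (by decide) (by decide) (by decide)
  have m3 := main 0 3 1 2 (by decide) (by decide) (by decide) (by decide) (by decide) (by decide)
  have m4 := main 0 1 2 4 (by decide) (by decide) (by decide) (by decide) (by decide) (by decide)
  have m5 := main 0 2 1 4 (by decide) (by decide) (by decide) (by decide) (by decide) (by decide)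
  have m6 := main 0 4 1 2 (by decide) (by decide) (by decide) (by decide) (by decide) (by decide)
  have m7 := main 0 1 3 4 (by decide) (by decide) (by decide) (by decide) (by decide) (by decide)
  have m8 := main 0 3 1 4 (by decide) (by decide) (by decide) (by decide) (by decide) (by decide)
  have m9 := main 0 4 1 3 (by decide) (by decide) (by decide) (by decide) (by decide) (by decide)
  have m10 := main 0 2 3 4 (by decide) (by decide) (by decide) (by decide) (by decide) (by decide)
  have m11 := main 0 3 2 4 (by decide) (by decide) (by decide) (by decide) (by decide) (by decide)
  have m12 := main 0 4 2 3 (by decide) (by decide) (by decide) (by decide) (by decide) (by decide)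
  have m13 := main 1 2 3 4 (by decide) (by decide) (by decide) (by decide) (by decide) (by decide)
  have m14 := main 1 3 2 4 (by decide) (by decide) (by decide) (by decide) (by decide) (by decide)
  have m15 := main 1 4 2 3 (by decide) (by decide) (by decide) (by decide) (by decide) (by decide)
  simp [sg] at m1 m2 m3 m4 m5 m6 m7 m8 m9 m10 m11 m12 m13 m14 m15
  omega

/-- Sets version, `p 0, p 1, p 2, μ, ν` the vertices. -/
theorem K5_sets (p : Fin 3 → ℂ) (μ ν : ℂ) (A M P : Fin 3 → Set ℂ) (R : Set ℂ)
    (hA : ∀ j k l, j ≠ k → j ≠ l → k ≠ l → JoinedIn (A l) (p j) (p k))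
    (hM : ∀ j, JoinedIn (M j) (p j) μ) (hP : ∀ j, JoinedIn (P j) (p j) ν)
    (hR : JoinedIn R μ ν)
    (dAM : ∀ l, Disjoint (A l) (M l)) (dAP : ∀ l, Disjoint (A l) (P l))
    (dAR : ∀ l, Disjoint (A l) R) (dMP : ∀ j k, j ≠ k → Disjoint (M j) (P k)) : False := by
  let q : Fin 5 → ℂ := ![p 0, p 1, p 2, μ, ν]
  let S : Fin 5 → Fin 5 → Set ℂ := ![![∅, A 2, A 1, M 0, P 0], ![∅, ∅, A 0, M 1, P 1],
    ![∅, ∅, ∅, M 2, P 2], ![∅, ∅, ∅, ∅, R], ![∅, ∅, ∅, ∅, ∅]]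
  have hJ : ∀ i j, i < j → JoinedIn (S i j) (q i) (q j) := by
    intro i j hij
    fin_cases i <;> fin_cases j <;> first
      | exact absurd hij (by decide)
      | exact hA _ _ _ (by decide) (by decide) (by decide)
      | exact hM _
      | exact hP _
      | exact hR
  have hD : ∀ i j k l, i < j → k < l → i ≠ k → i ≠ l → j ≠ k → j ≠ l →
      Disjoint (S i j) (S k l) := by
    intro i j k l hij hkl hik hil hjk hjl
    fin_cases i <;> fin_cases j <;> first
      | exact absurd hij (by decide)
      | (fin_cases k <;> fin_cases l <;> first
        | exact absurd hkl (by decide)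
        | exact absurd rfl hik
        | exact absurd rfl hil
        | exact absurd rfl hjk
        | exact absurd rfl hjl
        | exact dAM _
        | exact (dAM _).symm
        | exact dAP _
        | exact (dAP _).symm
        | exact dAR _
        | exact (dAR _).symm
        | exact dMP _ _ (by decide)
        | exact (dMP _ _ (by decide)).symm)
  have hex : ∀ i j, ∃ g : ℝ → ℂ, i < j → Continuous g ∧ g 0 = q i ∧ g 1 = q j ∧
      ∀ x, g x ∈ S i j := by
    intro i j
    by_cases h : i < j
    · obtain ⟨γ, hγ⟩ := hJ i j h
      refine ⟨γ.extend, fun _ => ⟨γ.continuous_extend, by simp, by simp, fun x => ?_⟩⟩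
      exact hγ (Set.projIcc 0 1 zero_le_one x)
    · exact ⟨0, fun h' => absurd h' h⟩
  choose G hG using hex
  refine K5_core q G (fun i j h => (hG i j h).1) (fun i j h => (hG i j h).2.1)
    (fun i j h => (hG i j h).2.2.1) ?_
  intro i j k l hij hkl hik hil hjk hjl x y heq
  exact Set.disjoint_left.1 (hD i j k l hij hkl hik hil hjk hjl) ((hG i j hij).2.2.2 x)
    (heq ▸ (hG k l hkl).2.2.2 y)

theorem K5_plane (p : Fin 3 → Plane) (μ ν : Plane) (A M P : Fin 3 → Set Plane) (R : Set Plane)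
    (hA : ∀ j k l, j ≠ k → j ≠ l → k ≠ l → JoinedIn (A l) (p j) (p k))
    (hM : ∀ j, JoinedIn (M j) (p j) μ) (hP : ∀ j, JoinedIn (P j) (p j) ν)
    (hR : JoinedIn R μ ν)
    (dAM : ∀ l, Disjoint (A l) (M l)) (dAP : ∀ l, Disjoint (A l) (P l))
    (dAR : ∀ l, Disjoint (A l) R) (dMP : ∀ j k, j ≠ k → Disjoint (M j) (P k)) : False := by
  let e : Plane → ℂ := Complex.orthonormalBasisOneI.repr.symm
  have hc : Continuous e := Complex.orthonormalBasisOneI.repr.symm.continuous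
  have hi : Function.Injective e := Complex.orthonormalBasisOneI.repr.symm.injective
  exact K5_sets (fun j => e (p j)) (e μ) (e ν) (fun j => e '' A j) (fun j => e '' M j)
    (fun j => e '' P j) (e '' R)
    (fun j k l h1 h2 h3 => (hA j k l h1 h2 h3).map hc) (fun j => (hM j).map hc)
    (fun j => (hP j).map hc) (hR.map hc)
    (fun l => (Set.disjoint_image_iff hi).2 (dAM l))
    (fun l => (Set.disjoint_image_iff hi).2 (dAP l))
    (fun l => (Set.disjoint_image_iff hi).2 (dAR l))
    (fun j k h => (Set.disjoint_image_iff hi).2 (dMP j k h))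

/-- `g` is a `1`-periodic parametrization of the closed curve `γ`. -/
def IsParam (g : ℝ → Plane) (γ : Set Plane) : Prop :=
  Continuous g ∧ Set.range g = γ ∧ ∀ x y, g x = g y ↔ ∃ n : ℤ, x = y + n

theorem exists_param (γ : Set Plane) (h : IsJordanCurve γ) : ∃ g, IsParam g γ := by
  obtain ⟨e⟩ := h
  have hmem : ∀ t : ℝ, (!₂[Real.cos t, Real.sin t] : Plane) ∈ Metric.sphere (0 : Plane) 1 := by
    intro t
    simp [EuclideanSpace.norm_eq]
  let c : ℝ → Metric.sphere (0 : Plane) 1 := fun t =>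
    ⟨!₂[Real.cos (2 * Real.pi * t), Real.sin (2 * Real.pi * t)], hmem _⟩
  have hcc : Continuous c := by
    apply Continuous.subtype_mk
    apply (PiLp.continuous_toLp 2 _).comp
    apply continuous_pi
    intro i
    fin_cases i <;> simp <;> fun_prop
  have hsurj : Function.Surjective c := by
    rintro ⟨v, hv⟩
    have hn : (v 0) ^ 2 + (v 1) ^ 2 = 1 := by
      have : ‖v‖ = 1 := by simpa using hv
      rw [EuclideanSpace.norm_eq] at this
      have := (Real.sqrt_eq_one).1 this
      simpa using this
    let z : ℂ := ⟨v 0, v 1⟩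
    have hz : ‖z‖ = 1 := by
      rw [Complex.norm_def, Complex.normSq_apply]
      simp only [z]
      rw [Real.sqrt_eq_one]; linarith
    refine ⟨Complex.arg z / (2 * Real.pi), ?_⟩
    apply Subtype.ext
    have h2 : 2 * Real.pi * (Complex.arg z / (2 * Real.pi)) = Complex.arg z := by
      field_simp
    have hz0 : z ≠ 0 := by
      intro h; rw [h] at hz; simp at hz
    ext i
    fin_cases i
    · simp [c, h2, Complex.cos_arg hz0, hz, z]
    · simp [c, h2, Complex.sin_arg, hz, z]
  have hinj : ∀ x y, c x = c y ↔ ∃ n : ℤ, x = y + n := by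
    intro x y
    have h1 : c x = c y ↔ Complex.exp ((2 * Real.pi * x : ℝ) * Complex.I)
        = Complex.exp ((2 * Real.pi * y : ℝ) * Complex.I) := by
      rw [Complex.ext_iff, Complex.exp_ofReal_mul_I_re, Complex.exp_ofReal_mul_I_re,
        Complex.exp_ofReal_mul_I_im, Complex.exp_ofReal_mul_I_im]
      constructor
      · intro h
        have h' := congrArg Subtype.val h
        have a := congrArg (fun v : Plane => v 0) h'
        have b := congrArg (fun v : Plane => v 1) h'
        simp only [c] at a b
        exact ⟨by simpa using a, by simpa using b⟩
      · rintro ⟨a, b⟩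
        apply Subtype.ext
        ext i
        fin_cases i
        · simpa [c] using a
        · simpa [c] using b
    rw [h1, Complex.exp_eq_exp_iff_exists_int]
    apply exists_congr
    intro n
    have hpi : (2 * Real.pi * Complex.I : ℂ) ≠ 0 := by simp [Real.pi_ne_zero]
    constructor
    · intro h
      have : (2 * Real.pi * Complex.I : ℂ) * (x : ℂ) = (2 * Real.pi * Complex.I) * ((y + n : ℝ) : ℂ) := by
        push_cast at h ⊢
        linear_combination h
      exact_mod_cast mul_left_cancel₀ hpi this
    · intro h
      rw [h]; push_cast; ring
  refine ⟨fun t => (e.symm (c t) : Plane), by fun_prop, ?_, ?_⟩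
  · ext v
    constructor
    · rintro ⟨t, rfl⟩
      exact (e.symm (c t)).2
    · intro hv
      obtain ⟨t, ht⟩ := hsurj (e ⟨v, hv⟩)
      exact ⟨t, by simp [ht]⟩
  · intro x y
    rw [← hinj, Subtype.coe_inj, e.symm.injective.eq_iff]

theorem joinedIn_image (g : ℝ → Plane) (hg : Continuous g) (S : Set ℝ) (hS : S.OrdConnected)
    (a b : ℝ) (ha : a ∈ S) (hb : b ∈ S) : JoinedIn (g '' S) (g a) (g b) :=
  ((hS.convex.isPathConnected ⟨a, ha⟩).joinedIn a ha b hb).map hg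

theorem IsParam.exists_Ico {g γ} (h : IsParam g γ) (u : ℝ) (x : Plane) (hx : x ∈ γ) :
    ∃ t ∈ Set.Ico u (u + 1), g t = x := by
  rw [← h.2.1] at hx
  obtain ⟨s, rfl⟩ := hx
  obtain ⟨n, hn, -⟩ := existsUnique_add_zsmul_mem_Ico (zero_lt_one' ℝ) s u
  refine ⟨_, hn, ?_⟩
  rw [h.2.2]
  exact ⟨n, by simp⟩

theorem IsParam.inj {g γ} (h : IsParam g γ) (u x y : ℝ) (hx : x ∈ Set.Ico u (u + 1))
    (hy : y ∈ Set.Ico u (u + 1)) (hxy : g x = g y) : x = y := by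
  obtain ⟨n, hn⟩ := (h.2.2 x y).1 hxy
  have h1 : ((n : ℤ) : ℝ) < 1 := by linarith [hx.2, hy.1]
  have h2 : (-1 : ℝ) < ((n : ℤ) : ℝ) := by linarith [hx.1, hy.2]
  have h3 : n < 1 := by exact_mod_cast h1
  have h4 : -1 < n := by exact_mod_cast h2
  have : n = 0 := by omega
  simpa [this] using hn

theorem IsParam.mem {g γ} (h : IsParam g γ) (x : ℝ) : g x ∈ γ := h.2.1 ▸ ⟨x, rfl⟩

theorem joinedIn_diff {g γ} (h : IsParam g γ) (x y z : Plane) (hx : x ∈ γ) (hy : y ∈ γ)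
    (hz : z ∈ γ) (hxz : x ≠ z) (hyz : y ≠ z) : JoinedIn (γ \ {z}) x y := by
  obtain ⟨u, -, rfl⟩ := h.exists_Ico 0 z hz
  obtain ⟨a, ha, rfl⟩ := h.exists_Ico u x hx
  obtain ⟨b, hb, rfl⟩ := h.exists_Ico u y hy
  have ha' : a ∈ Set.Ioo u (u + 1) :=
    ⟨lt_of_le_of_ne ha.1 (fun e => hxz (by rw [e])), ha.2⟩
  have hb' : b ∈ Set.Ioo u (u + 1) :=
    ⟨lt_of_le_of_ne hb.1 (fun e => hyz (by rw [e])), hb.2⟩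
  refine (joinedIn_image g h.1 _ Set.ordConnected_Ioo a b ha' hb').mono ?_
  rintro _ ⟨t, ht, rfl⟩
  refine ⟨h.mem t, fun e => ?_⟩
  have := h.inj u t u ⟨ht.1.le, ht.2⟩ ⟨le_rfl, by linarith⟩ e
  exact ht.1.ne' this

theorem exists_cross (A0 : Set Plane) (gA : ℝ → Plane) (hA : IsParam gA A0)
    (g : Fin 3 → ℝ → Plane) (b : Fin 3 → Set Plane) (hb : ∀ j, IsParam (g j) (b j))
    (Em Ep : Set Plane) (hEm : ∀ x ∈ Em, ∀ y ∈ Em, JoinedIn Em x y)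
    (hEp : ∀ x ∈ Ep, ∀ y ∈ Ep, JoinedIn Ep x y)
    (x y z : Fin 3 → ℝ) (hxy : ∀ j, x j < y j) (hyz : ∀ j, y j < z j)
    (hx : ∀ j, g j (x j) ∈ Em) (hz : ∀ j, g j (z j) ∈ Ep)
    (hy : ∀ j, b j ∩ A0 = {g j (y j)})
    (dist : ∀ j k, j ≠ k → g j (y j) ≠ g k (y k))
    (d1 : Disjoint Em Ep) (d2 : Disjoint Em A0) (d3 : Disjoint Ep A0)
    (d4 : ∀ j, Disjoint (g j '' Set.Icc (y j) (z j)) Em)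
    (d5 : ∀ j, Disjoint (g j '' Set.Icc (x j) (y j)) Ep) :
    ∃ j k, j ≠ k ∧ ∃ u ∈ Set.Icc (x j) (y j), ∃ v ∈ Set.Icc (y k) (z k), g j u = g k v := by
  by_contra hcon
  push Not at hcon
  have hyA : ∀ j, g j (y j) ∈ A0 := fun j =>
    ((hy j).symm ▸ Set.mem_singleton _ : g j (y j) ∈ b j ∩ A0).2
  have honly : ∀ j v, g j v ∈ A0 → g j v = g j (y j) := fun j v hv => by
    have : g j v ∈ b j ∩ A0 := ⟨(hb j).mem v, hv⟩
    rw [hy j] at this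
    exact this
  have hseg : ∀ j (s t a c : ℝ), a ∈ Set.Icc s t → c ∈ Set.Icc s t →
      JoinedIn (g j '' Set.Icc s t) (g j a) (g j c) := fun j s t a c ha hc =>
    joinedIn_image _ (hb j).1 _ Set.ordConnected_Icc a c ha hc
  refine K5_plane (fun j => g j (y j)) (g 0 (x 0)) (g 0 (z 0)) (fun l => A0 \ {g l (y l)})
    (fun j => g j '' Set.Icc (x j) (y j) ∪ Em) (fun j => g j '' Set.Icc (y j) (z j) ∪ Ep)
    (b 0 \ {g 0 (y 0)}) ?_ ?_ ?_ ?_ ?_ ?_ ?_ ?_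
  · intro j k l hjk hjl hkl
    exact joinedIn_diff hA _ _ _ (hyA j) (hyA k) (hyA l) (dist j l hjl) (dist k l hkl)
  · intro j
    have h1 := hseg j (x j) (y j) (y j) (x j) ⟨(hxy j).le, le_rfl⟩ ⟨le_rfl, (hxy j).le⟩
    exact (h1.mono Set.subset_union_left).trans
      ((hEm _ (hx j) _ (hx 0)).mono Set.subset_union_right)
  · intro j
    have h1 := hseg j (y j) (z j) (y j) (z j) ⟨le_rfl, (hyz j).le⟩ ⟨(hyz j).le, le_rfl⟩
    exact (h1.mono Set.subset_union_left).trans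
      ((hEp _ (hz j) _ (hz 0)).mono Set.subset_union_right)
  · refine joinedIn_diff (hb 0) _ _ _ ((hb 0).mem _) ((hb 0).mem _) ((hb 0).mem _) ?_ ?_
    · intro e
      exact Set.disjoint_left.1 d2 (hx 0) (e ▸ hyA 0)
    · intro e
      exact Set.disjoint_left.1 d3 (hz 0) (e ▸ hyA 0)
  · intro l
    rw [Set.disjoint_left]
    rintro w ⟨hw, hwl⟩ (⟨t, ht, rfl⟩ | hwE)
    · exact hwl (honly l t hw)
    · exact Set.disjoint_left.1 d2 hwE hw
  · intro l
    rw [Set.disjoint_left]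
    rintro w ⟨hw, hwl⟩ (⟨t, ht, rfl⟩ | hwE)
    · exact hwl (honly l t hw)
    · exact Set.disjoint_left.1 d3 hwE hw
  · intro l
    rw [Set.disjoint_left]
    rintro w ⟨hw, hwl⟩ ⟨hb0, hw0⟩
    have : w ∈ b 0 ∩ A0 := ⟨hb0, hw⟩
    rw [hy 0] at this
    exact hw0 this
  · intro j k hjk
    rw [Set.disjoint_left]
    rintro w (⟨t, ht, rfl⟩ | hwE) (⟨s, hs, hst⟩ | hwE')
    · exact hcon j k hjk t ht s hs hst.symm
    · exact Set.disjoint_left.1 (d5 j) ⟨t, ht, rfl⟩ hwE'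
    · exact Set.disjoint_left.1 (d4 k) ⟨s, hs, hst⟩ hwE
    · exact Set.disjoint_left.1 d1 hwE hwE'

theorem three_bound (m s n : ℕ) (γ : Fin n → Set Plane) (hG : GenPos γ) (hM : MIntersecting m γ)
    (a : Fin s → Fin n) (ha : Function.Injective a) (β : Fin 3 → Fin n)
    (hβ : Function.Injective β) (hne : ∀ i j, a i ≠ β j)
    (g : Fin n → ℝ → Plane) (hg : ∀ v, IsParam (g v) (γ v))
    (y : Fin 3 → Fin s → ℝ) (hy : ∀ j i, y j i ∈ Set.Ico (0 : ℝ) (0 + 1))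
    (ht : ∀ j i, γ (β j) ∩ γ (a i) = {g (β j) (y j i)})
    (hmono : ∀ j, StrictMono (y j))
    (E : Fin s → Set Plane) (hEsub : ∀ i, E i ⊆ γ (a i))
    (hEj : ∀ i, ∀ x ∈ E i, ∀ x' ∈ E i, JoinedIn (E i) x x')
    (hEd : ∀ i i', i ≠ i' → Disjoint (E i) (γ (a i')))
    (hyE : ∀ j i, g (β j) (y j i) ∈ E i) : s ≤ 3 * m + 2 := by
  have hmemA : ∀ j i, g (β j) (y j i) ∈ γ (a i) := fun j i => hEsub i (hyE j i)
  have honly : ∀ j i t, t ∈ Set.Ico (0 : ℝ) (0 + 1) → g (β j) t ∈ γ (a i) → t = y j i := by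
    intro j i t ht' h
    have : g (β j) t ∈ γ (β j) ∩ γ (a i) := ⟨(hg _).mem _, h⟩
    rw [ht j i] at this
    exact (hg (β j)).inj 0 _ _ ht' (hy j i) this
  have hIcc : ∀ j i i' t, t ∈ Set.Icc (y j i) (y j i') → t ∈ Set.Ico (0 : ℝ) (0 + 1) :=
    fun j i i' t h => ⟨(hy j i).1.trans h.1, h.2.trans_lt (hy j i').2⟩
  -- the crossings
  have key : ∀ r : Fin (s - 2), ∃ (i0 i1 i2 : Fin s), i0.val = r.val ∧ i1.val = r.val + 1 ∧
      i2.val = r.val + 2 ∧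
      ∃ j k, j ≠ k ∧ ∃ u v, y j i0 < u ∧ u < y j i1 ∧ y k i1 < v ∧ v < y k i2 ∧
        g (β j) u = g (β k) v := by
    intro r
    have hr := r.2
    let i0 : Fin s := ⟨r, by omega⟩
    let i1 : Fin s := ⟨r + 1, by omega⟩
    let i2 : Fin s := ⟨r + 2, by omega⟩
    have h01 : i0 < i1 := by simp [i0, i1, Fin.lt_def]
    have h12 : i1 < i2 := by simp [i2, i1, Fin.lt_def]
    refine ⟨i0, i1, i2, rfl, rfl, rfl, ?_⟩
    obtain ⟨j, k, hjk, u, hu, v, hv, huv⟩ := exists_cross (γ (a i1)) (g (a i1)) (hg _)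
      (fun j => g (β j)) (fun j => γ (β j)) (fun j => hg _) (E i0) (E i2) (hEj _) (hEj _)
      (fun j => y j i0) (fun j => y j i1) (fun j => y j i2) (fun j => hmono j h01)
      (fun j => hmono j h12) (fun j => hyE j _) (fun j => hyE j _) (fun j => ht j _)
      (by
        intro j k hjk e
        have h1 := (hg (β j)).mem (y j i1)
        have h2 := (hg (β k)).mem (y k i1)
        rw [← e] at h2
        rcases hG.2 _ _ _ _ h1 h2 (hmemA j i1) with h | h | h
        · exact hjk (hβ h)
        · exact hne _ _ h.symm
        · exact hne _ _ h.symm)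
      ((hEd _ _ (h01.trans h12).ne).mono_right (hEsub _))
      (hEd _ _ h01.ne) (hEd _ _ h12.ne')
      (by
        intro j
        rw [Set.disjoint_left]
        rintro _ ⟨t, ht', rfl⟩ hE
        have := honly j i0 t (hIcc j _ _ t ht') (hEsub _ hE)
        have h3 := hmono j h01
        have h4 := ht'.1
        linarith)
      (by
        intro j
        rw [Set.disjoint_left]
        rintro _ ⟨t, ht', rfl⟩ hE
        have := honly j i2 t (hIcc j _ _ t ht') (hEsub _ hE)
        have h3 := hmono j h12
        have h4 := ht'.2
        linarith)
    have hnot : ∀ i, g (β j) u ∉ γ (a i) := by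
      intro i hi
      have h1 := (hg (β j)).mem u
      have h2 := (hg (β k)).mem v
      rw [← huv] at h2
      rcases hG.2 _ _ _ _ h1 h2 hi with h | h | h
      · exact hjk (hβ h)
      · exact hne _ _ h.symm
      · exact hne _ _ h.symm
    refine ⟨j, k, hjk, u, v, ?_, ?_, ?_, ?_, huv⟩
    · exact lt_of_le_of_ne hu.1 (fun e => hnot i0 (e ▸ hmemA j i0))
    · exact lt_of_le_of_ne hu.2 (fun e => hnot i1 (e ▸ hmemA j i1))
    · refine lt_of_le_of_ne hv.1 (fun e => hnot i1 ?_)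
      rw [huv, ← e]; exact hmemA k i1
    · refine lt_of_le_of_ne hv.2 (fun e => hnot i2 ?_)
      rw [huv, e]; exact hmemA k i2
  choose i0 i1 i2 e0 e1 e2 j k hjk u v hu0 hu1 hv1 hv2 huv using key
  let f : Fin (s - 2) → Plane := fun r => g (β (j r)) (u r)
  have hf1 : ∀ r, f r ∈ γ (β (j r)) := fun r => (hg _).mem _
  have hf2 : ∀ r, f r ∈ γ (β (k r)) := fun r => by
    simp only [f]; rw [huv]; exact (hg _).mem _
  have hu : ∀ r, u r ∈ Set.Ico (0 : ℝ) (0 + 1) := fun r =>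
    ⟨(hy _ _).1.trans (hu0 r).le, (hu1 r).trans (hy _ _).2⟩
  have hv : ∀ r, v r ∈ Set.Ico (0 : ℝ) (0 + 1) := fun r =>
    ⟨(hy _ _).1.trans (hv1 r).le, (hv2 r).trans (hy _ _).2⟩
  have hinj : Function.Injective f := by
    intro r r' hrr
    have hj' : j r' = j r ∨ j r' = k r := by
      rcases hG.2 (f r) _ _ _ (hf1 r) (hf2 r) (hrr ▸ hf1 r') with h | h | h
      · exact absurd (hβ h) (hjk r)
      · exact Or.inl (hβ h).symm
      · exact Or.inr (hβ h).symm
    have hk' : k r' = j r ∨ k r' = k r := by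
      rcases hG.2 (f r) _ _ _ (hf1 r) (hf2 r) (hrr ▸ hf2 r') with h | h | h
      · exact absurd (hβ h) (hjk r)
      · exact Or.inl (hβ h).symm
      · exact Or.inr (hβ h).symm
    have a0 := hu0 r
    have a1 := hu1 r
    have a0' := hu0 r'
    have a1' := hu1 r'
    have b0 := hv1 r
    have b1 := hv2 r
    have b0' := hv1 r'
    have b1' := hv2 r'
    have E0 := e0 r
    have E1 := e1 r
    have E2 := e2 r
    have E0' := e0 r'
    have E1' := e1 r'
    have E2' := e2 r'
    rcases hj' with hj' | hj'
    · -- same roles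
      have : u r = u r' := by
        apply (hg (β (j r))).inj 0 _ _ (hu r) (hu r')
        have : g (β (j r)) (u r) = g (β (j r')) (u r') := hrr
        rwa [hj'] at this
      rw [hj', ← this] at a0' a1'
      have c1 := (hmono (j r)).lt_iff_lt.1 (a0.trans a1')
      have c2 := (hmono (j r)).lt_iff_lt.1 (a0'.trans a1)
      rw [Fin.lt_def] at c1 c2
      apply Fin.ext
      omega
    · have hk'' : k r' = j r := by
        rcases hk' with h | h
        · exact h
        · exact absurd (hj'.trans h.symm) (hjk r')
      have t1 : u r = v r' := by
        apply (hg (β (j r))).inj 0 _ _ (hu r) (hv r')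
        have h1 : g (β (j r)) (u r) = g (β (j r')) (u r') := hrr
        rw [h1, huv r', hk'']
      have t2 : v r = u r' := by
        apply (hg (β (k r))).inj 0 _ _ (hv r) (hu r')
        have h1 : g (β (j r)) (u r) = g (β (j r')) (u r') := hrr
        rw [← huv r, h1, hj']
      rw [hj', ← t2] at a0' a1'
      rw [hk'', ← t1] at b0' b1'
      have c1 := (hmono (j r)).lt_iff_lt.1 (a0.trans b1')
      have c2 := (hmono (j r)).lt_iff_lt.1 (b0'.trans a1)
      have c3 := (hmono (k r)).lt_iff_lt.1 (b0.trans a1')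
      have c4 := (hmono (k r)).lt_iff_lt.1 (a0'.trans b1)
      rw [Fin.lt_def] at c1 c2 c3 c4
      omega
  let S : Set Plane := (γ (β 0) ∩ γ (β 1)) ∪ (γ (β 0) ∩ γ (β 2)) ∪ (γ (β 1) ∩ γ (β 2))
  have n01 : β 0 ≠ β 1 := fun h => absurd (hβ h) (by decide)
  have n02 : β 0 ≠ β 2 := fun h => absurd (hβ h) (by decide)
  have n12 : β 1 ≠ β 2 := fun h => absurd (hβ h) (by decide)
  have hSfin : S.Finite := ((hG.1 _ _ n01).union (hG.1 _ _ n02)).union (hG.1 _ _ n12)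
  have hScard : S.ncard ≤ 3 * m := by
    have h1 := Set.ncard_union_le ((γ (β 0) ∩ γ (β 1)) ∪ (γ (β 0) ∩ γ (β 2)))
      (γ (β 1) ∩ γ (β 2))
    have h2 := Set.ncard_union_le (γ (β 0) ∩ γ (β 1)) (γ (β 0) ∩ γ (β 2))
    have := hM _ _ n01
    have := hM _ _ n02
    have := hM _ _ n12
    simp only [S]
    omega
  have hfS : ∀ r, f r ∈ S := by
    have aux : ∀ (j k : Fin 3) (x : Plane), j ≠ k → x ∈ γ (β j) → x ∈ γ (β k) → x ∈ S := by
      intro j k x hjk h1 h2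
      fin_cases j <;> fin_cases k <;> first
        | exact absurd rfl hjk
        | exact Or.inl (Or.inl ⟨h1, h2⟩)
        | exact Or.inl (Or.inl ⟨h2, h1⟩)
        | exact Or.inl (Or.inr ⟨h1, h2⟩)
        | exact Or.inl (Or.inr ⟨h2, h1⟩)
        | exact Or.inr ⟨h1, h2⟩
        | exact Or.inr ⟨h2, h1⟩
    exact fun r => aux _ _ _ (hjk r) (hf1 r) (hf2 r)
  have hle : (f '' Set.univ).ncard ≤ S.ncard :=
    Set.ncard_le_ncard (by rintro _ ⟨r, -, rfl⟩; exact hfS r) hSfin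
  rw [Set.ncard_image_of_injective _ hinj, Set.ncard_univ, Nat.card_eq_fintype_card,
    Fintype.card_fin] at hle
  omega

/-- number of elements of `F` below `x` -/
def cls (F : Finset ℝ) (x : ℝ) : ℕ := (F.filter (· < x)).card

theorem cls_le (F : Finset ℝ) (x : ℝ) : cls F x ≤ F.card := Finset.card_filter_le _ _

theorem cls_ordConnected (F : Finset ℝ) (N : ℕ) :
    {x : ℝ | x ∈ Set.Ico (0 : ℝ) (0 + 1) ∧ x ∉ F ∧ cls F x = N}.OrdConnected := by
  constructor
  rintro x ⟨hx, hxF, hxN⟩ y ⟨hy, hyF, hyN⟩ z ⟨hxz, hzy⟩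
  have m1 : F.filter (· < x) ⊆ F.filter (· < z) := fun w hw => by
    simp only [Finset.mem_filter] at hw ⊢; exact ⟨hw.1, hw.2.trans_le hxz⟩
  have m2 : F.filter (· < z) ⊆ F.filter (· < y) := fun w hw => by
    simp only [Finset.mem_filter] at hw ⊢; exact ⟨hw.1, hw.2.trans_le hzy⟩
  have c1 := Finset.card_le_card m1
  have c2 := Finset.card_le_card m2
  simp only [cls] at hxN hyN
  refine ⟨⟨hx.1.trans hxz, hzy.trans_lt hy.2⟩, ?_, by simp only [cls]; omega⟩
  intro hzF
  have hzy' : z < y := lt_of_le_of_ne hzy (fun e => hyF (e ▸ hzF))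
  have : F.filter (· < z) = F.filter (· < y) := Finset.eq_of_subset_of_card_le m2 (by omega)
  have hz : z ∈ F.filter (· < y) := by simp [hzF, hzy']
  rw [← this] at hz
  simp at hz

theorem no_K (m s : ℕ) : ∃ t : ℕ, ∀ (n : ℕ) (γ : Fin n → Set Plane),
    (∀ i, IsJordanCurve (γ i)) → GenPos γ → MIntersecting m γ →
    ∀ (a : Fin s → Fin n), Function.Injective a → ∀ B : Finset (Fin n), t ≤ B.card →
    (∀ i, ∀ b ∈ B, a i ≠ b ∧ Touches (γ (a i)) (γ b)) → s ≤ 3 * m + 2 := by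
  classical
  refine ⟨Fintype.card ((Fin s → Fin s → Bool) × (Fin s → Fin (s * m + 1))) * 2 + 1, ?_⟩
  intro n γ hJ hG hM a ha B hB hT
  choose g hg using fun v => exists_param (γ v) (hJ v)
  have hpinv : ∀ v x, ∃ t : ℝ, x ∈ γ v → t ∈ Set.Ico (0 : ℝ) (0 + 1) ∧ g v t = x := by
    intro v x
    by_cases h : x ∈ γ v
    · obtain ⟨t, h1, h2⟩ := (hg v).exists_Ico 0 x h
      exact ⟨t, fun _ => ⟨h1, h2⟩⟩
    · exact ⟨0, fun h' => absurd h' h⟩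
  choose pinv hpinv using hpinv
  have hτ : ∀ i b, ∃ x, b ∈ B → γ (a i) ∩ γ b = {x} := by
    intro i b
    by_cases h : b ∈ B
    · obtain ⟨x, hx⟩ := (hT i b h).2
      exact ⟨x, fun _ => hx⟩
    · exact ⟨0, fun h' => absurd h' h⟩
  choose τ hτ using hτ
  have hτm : ∀ i b, b ∈ B → τ i b ∈ γ (a i) ∧ τ i b ∈ γ b := by
    intro i b hb
    have : τ i b ∈ γ (a i) ∩ γ b := by rw [hτ i b hb]; exact rfl
    exact this
  have hfin : ∀ i i' : Fin s, ∃ T : Finset Plane, i ≠ i' → (T : Set Plane) = γ (a i) ∩ γ (a i') ∧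
      T.card ≤ m := by
    intro i i'
    by_cases h : i = i'
    · exact ⟨∅, fun h' => absurd h h'⟩
    · have hf := hG.1 _ _ (fun e => h (ha e) : a i ≠ a i')
      refine ⟨hf.toFinset, fun _ => ⟨by simp, ?_⟩⟩
      rw [← Set.ncard_eq_toFinset_card _ hf]
      exact hM _ _ (fun e => h (ha e))
  choose T hTT using hfin
  let F : Fin s → Finset ℝ := fun i =>
    ((Finset.univ.erase i).biUnion (fun i' => T i i')).image (pinv (a i))
  have hFcard : ∀ i, (F i).card ≤ s * m := by
    intro i
    refine Finset.card_image_le.trans ?_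
    refine (Finset.card_biUnion_le_card_mul _ _ m ?_).trans ?_
    · intro i' hi'
      exact (hTT i i' (Finset.ne_of_mem_erase hi').symm).2
    · apply Nat.mul_le_mul_right
      exact (Finset.card_erase_le).trans (by simp)
  have hFmem : ∀ i i' x, i ≠ i' → x ∈ Set.Ico (0 : ℝ) (0 + 1) → g (a i) x ∈ γ (a i') →
      x ∈ F i := by
    intro i i' x hii hx hgx
    have h1 := (hg (a i)).mem x
    obtain ⟨h2, h3⟩ := hpinv (a i) (g (a i) x) h1
    have h4 := (hg (a i)).inj 0 _ _ h2 hx h3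
    refine Finset.mem_image.2 ⟨g (a i) x, ?_, h4⟩
    refine Finset.mem_biUnion.2 ⟨i', by simp [hii.symm], ?_⟩
    rw [← Finset.mem_coe, (hTT i i' hii).1]
    exact ⟨h1, hgx⟩
  have hFmem' : ∀ i x, x ∈ Set.Ico (0 : ℝ) (0 + 1) → x ∈ F i →
      ∃ i', i ≠ i' ∧ g (a i) x ∈ γ (a i') := by
    intro i x hx hxF
    obtain ⟨w, hw, hwx⟩ := Finset.mem_image.1 hxF
    obtain ⟨i', hi', hw'⟩ := Finset.mem_biUnion.1 hw
    have hii := (Finset.ne_of_mem_erase hi').symm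
    rw [← Finset.mem_coe, (hTT i i' hii).1] at hw'
    refine ⟨i', hii, ?_⟩
    rw [← hwx, (hpinv (a i) w hw'.1).2]
    exact hw'.2
  let Y : Fin n → Fin s → ℝ := fun b i => pinv b (τ i b)
  let Q : Fin n → Fin s → ℝ := fun b i => pinv (a i) (τ i b)
  let dat : Fin n → (Fin s → Fin s → Bool) × (Fin s → Fin (s * m + 1)) := fun b =>
    (fun i i' => decide (Y b i < Y b i'),
     fun i => ⟨cls (F i) (Q b i), Nat.lt_succ_of_le ((cls_le _ _).trans (hFcard i))⟩)
  obtain ⟨d, -, hd⟩ := Finset.exists_lt_card_fiber_of_mul_lt_card_of_maps_to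
    (s := B) (t := Finset.univ) (f := dat) (n := 2) (fun _ _ => Finset.mem_univ _)
    (by rw [Finset.card_univ]; omega)
  obtain ⟨b0, hb0, b1, hb1, b2, hb2, h01, h02, h12⟩ := Finset.two_lt_card.1 hd
  let β : Fin 3 → Fin n := ![b0, b1, b2]
  have hβinj : Function.Injective β := by
    intro j k h
    fin_cases j <;> fin_cases k <;> simp [β] at h ⊢ <;> first
      | exact h01 h
      | exact h02 h
      | exact h12 h
      | exact h01 h.symm
      | exact h02 h.symm
      | exact h12 h.symm
  have hβ : ∀ j, β j ∈ B ∧ dat (β j) = d := by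
    intro j
    fin_cases j
    · exact Finset.mem_filter.1 hb0
    · exact Finset.mem_filter.1 hb1
    · exact Finset.mem_filter.1 hb2
  have hord : ∀ j i i', Y (β j) i < Y (β j) i' ↔ Y (β 0) i < Y (β 0) i' := by
    intro j i i'
    have h1 : dat (β j) = dat (β 0) := (hβ j).2.trans (hβ 0).2.symm
    have h2 := congrFun (congrFun (congrArg Prod.fst h1) i) i'
    simpa [dat] using h2
  have hcls : ∀ j i, cls (F i) (Q (β j) i) = cls (F i) (Q (β 0) i) := by
    intro j i
    have h1 : dat (β j) = dat (β 0) := (hβ j).2.trans (hβ 0).2.symm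
    have h2 := congrFun (congrArg Prod.snd h1) i
    simpa [dat] using h2
  have hY : ∀ b ∈ B, ∀ i, Y b i ∈ Set.Ico (0 : ℝ) (0 + 1) ∧ g b (Y b i) = τ i b :=
    fun b hb i => hpinv b _ (hτm i b hb).2
  have hQ : ∀ b ∈ B, ∀ i, Q b i ∈ Set.Ico (0 : ℝ) (0 + 1) ∧ g (a i) (Q b i) = τ i b :=
    fun b hb i => hpinv (a i) _ (hτm i b hb).1
  have hthree : ∀ b ∈ B, ∀ i i', τ i b ∈ γ (a i') → i = i' := by
    intro b hb i i' h
    rcases hG.2 _ _ _ _ (hτm i b hb).1 h (hτm i b hb).2 with h | h | h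
    · exact ha h
    · exact absurd h (hT i b hb).1
    · exact absurd h (hT i' b hb).1
  have hYinj : Function.Injective (Y (β 0)) := by
    intro i i' h
    apply hthree _ (hβ 0).1
    rw [← (hY _ (hβ 0).1 i).2, h, (hY _ (hβ 0).1 i').2]
    exact (hτm i' _ (hβ 0).1).1
  let σ := Tuple.sort (Y (β 0))
  have hσ : StrictMono (Y (β 0) ∘ σ) :=
    (Tuple.monotone_sort (Y (β 0))).strictMono_of_injective (hYinj.comp σ.injective)
  let E : Fin s → Set Plane := fun i =>
    g (a i) '' {x : ℝ | x ∈ Set.Ico (0 : ℝ) (0 + 1) ∧ x ∉ F i ∧ cls (F i) x = cls (F i) (Q (β 0) i)}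
  refine three_bound m s n γ hG hM (fun i => a (σ i)) (ha.comp σ.injective) β hβinj
    (fun i j => (hT _ _ (hβ j).1).1) g hg (fun j i => Y (β j) (σ i))
    (fun j i => (hY _ (hβ j).1 _).1) ?_ ?_ (fun i => E (σ i)) ?_ ?_ ?_ ?_
  · intro j i
    rw [(hY _ (hβ j).1 _).2, ← hτ _ _ (hβ j).1, Set.inter_comm]
  · intro j i i' hii
    exact (hord j _ _).2 (hσ hii)
  · rintro i _ ⟨x, -, rfl⟩
    exact (hg _).mem x
  · rintro i _ ⟨x, hx, rfl⟩ _ ⟨x', hx', rfl⟩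
    exact joinedIn_image _ (hg _).1 _ (cls_ordConnected _ _) x x' hx hx'
  · intro i i' hii
    rw [Set.disjoint_left]
    rintro _ ⟨x, hx, rfl⟩ hx'
    exact hx.2.1 (hFmem _ _ x (fun e => hii (σ.injective e)) hx.1 hx')
  · intro j i
    refine ⟨Q (β j) (σ i), ⟨(hQ _ (hβ j).1 _).1, ?_, hcls j _⟩, ?_⟩
    · intro hF
      obtain ⟨i', hii, h⟩ := hFmem' _ _ (hQ _ (hβ j).1 _).1 hF
      rw [(hQ _ (hβ j).1 _).2] at h
      exact hii (hthree _ (hβ j).1 _ _ h)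
    · rw [(hQ _ (hβ j).1 _).2, (hY _ (hβ j).1 _).2]

theorem card_eq_le (s n : ℕ) (i j : Fin s) (hij : i ≠ j) :
    (Finset.univ.filter (fun f : Fin s → Fin n => f i = f j)).card ≤ n ^ (s - 1) := by
  classical
  have h : Fintype.card ({k : Fin s // k ≠ j} → Fin n) = n ^ (s - 1) := by
    rw [Fintype.card_fun, Fintype.card_fin, Fintype.card_subtype_compl, Fintype.card_fin,
      Fintype.card_subtype_eq]
  rw [← h, ← Finset.card_univ]
  apply Finset.card_le_card_of_injOn (fun f k => f k.1) (fun _ _ => Finset.mem_univ _)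
  intro f hf f' hf' hff
  have hf := (Finset.mem_filter.1 hf).2
  have hf' := (Finset.mem_filter.1 hf').2
  funext k
  by_cases hk : k = j
  · subst hk
    rw [← hf, ← hf']
    exact congrFun hff ⟨i, hij⟩
  · exact congrFun hff ⟨k, hk⟩

theorem kst_count (s t n : ℕ) (hs : 1 ≤ s) (r : Fin n → Fin n → Prop) [DecidableRel r]
    (h : ∀ a : Fin s → Fin n, Function.Injective a →
      (Finset.univ.filter (fun v => ∀ i, r (a i) v)).card ≤ t) :
    (∑ v, (Finset.univ.filter (fun w => r w v)).card) ^ s ≤ (t + s * s) * n ^ (2 * s - 1) := by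
  classical
  have h1 : ∀ v, (Finset.univ.filter (fun w => r w v)).card ^ s
      = (Finset.univ.filter (fun f : Fin s → Fin n => ∀ i, r (f i) v)).card := by
    intro v
    have : (Finset.univ.filter (fun f : Fin s → Fin n => ∀ i, r (f i) v))
        = Fintype.piFinset (fun _ : Fin s => Finset.univ.filter (fun w => r w v)) := by
      ext f; simp [Fintype.mem_piFinset]
    rw [this, Fintype.card_piFinset]; simp
  have h2 : ∑ v, (Finset.univ.filter (fun w => r w v)).card ^ s
      = ∑ f : Fin s → Fin n, (Finset.univ.filter (fun v => ∀ i, r (f i) v)).card := by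
    simp_rw [h1, Finset.card_filter]
    rw [Finset.sum_comm]
  have h3 : ∀ f : Fin s → Fin n, (Finset.univ.filter (fun v => ∀ i, r (f i) v)).card
      ≤ t + ∑ p ∈ (Finset.univ : Finset (Fin s)).offDiag, if f p.1 = f p.2 then n else 0 := by
    intro f
    by_cases hf : Function.Injective f
    · exact (h f hf).trans (Nat.le_add_right _ _)
    · simp only [Function.Injective, not_forall] at hf
      obtain ⟨i, j, hij, hne⟩ := hf
      have : (Finset.univ.filter (fun v => ∀ i, r (f i) v)).card ≤ n :=
        (Finset.card_le_univ _).trans (by simp)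
      refine this.trans (le_trans ?_ (Nat.le_add_left _ _))
      have := Finset.single_le_sum (f := fun p : Fin s × Fin s => if f p.1 = f p.2 then n else 0)
        (s := (Finset.univ : Finset (Fin s)).offDiag) (fun _ _ => Nat.zero_le _)
        (a := (i, j)) (by simp [hne])
      simpa [hij] using this
  have h4 : ∑ f : Fin s → Fin n, (Finset.univ.filter (fun v => ∀ i, r (f i) v)).card
      ≤ (t + s * s) * n ^ s := by
    refine (Finset.sum_le_sum (fun f _ => h3 f)).trans ?_
    rw [Finset.sum_add_distrib, Finset.sum_comm]
    have h5 : ∀ p ∈ (Finset.univ : Finset (Fin s)).offDiag,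
        ∑ f : Fin s → Fin n, (if f p.1 = f p.2 then n else 0) ≤ n ^ s := by
      intro p hp
      rw [← Finset.sum_filter, Finset.sum_const, smul_eq_mul]
      calc _ ≤ n ^ (s - 1) * n := Nat.mul_le_mul_right _ (card_eq_le s n _ _ (by simpa using hp))
        _ = n ^ s := by rw [← pow_succ]; congr 1; omega
    have h6 := Finset.sum_le_card_nsmul _ _ _ h5
    have h7 : ((Finset.univ : Finset (Fin s)).offDiag).card ≤ s * s := by
      rw [Finset.offDiag_card]; simp
    have h8 : ∑ _f : Fin s → Fin n, t = t * n ^ s := by simp [mul_comm]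
    rw [h8, add_mul]
    refine Nat.add_le_add_left (h6.trans ?_) _
    rw [smul_eq_mul]
    exact Nat.mul_le_mul_right _ h7
  obtain ⟨k, rfl⟩ : ∃ k, s = k + 1 := ⟨s - 1, by omega⟩
  have h9 := pow_sum_le_card_mul_sum_pow (s := (Finset.univ : Finset (Fin n)))
    (f := fun v => (Finset.univ.filter (fun w => r w v)).card) (fun _ _ => Nat.zero_le _) k
  rw [h2, Finset.card_univ, Fintype.card_fin, Nat.cast_id] at h9
  refine h9.trans ((Nat.mul_le_mul_left _ h4).trans (le_of_eq ?_))
  have e : 2 * (k + 1) - 1 = k + (k + 1) := by omega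
  rw [e, pow_add]
  ring

/-- Theorem (Main 1, for closed Jordan curves): every `m`-intersecting family of `n`
closed Jordan curves in general position has `O(n^(2 - 1/(3m+15)))` touching pairs. -/
theorem touching_pairs_upper_bound (m : ℕ) (hm : 1 ≤ m) :
    ∃ C : ℝ, 0 < C ∧
      ∀ (n : ℕ) (γ : Fin n → Set Plane),
        Function.Injective γ →
        (∀ i, IsJordanCurve (γ i)) →
        GenPos γ →
        MIntersecting m γ →
        (touchingPairs γ : ℝ) ≤ C * (n : ℝ) ^ ((2 : ℝ) - 1 / (3 * m + 15)) := by
  classical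
  have _ := hm
  obtain ⟨t, ht⟩ := no_K m (3 * m + 15)
  set s := 3 * m + 15 with hs
  have hs1 : 1 ≤ s := by omega
  have hsR : (3 * (m : ℝ) + 15) = (s : ℝ) := by rw [hs]; push_cast; ring
  have hspos : (0 : ℝ) < s := by exact_mod_cast hs1
  have hK1 : (1 : ℝ) ≤ ((t + s * s : ℕ) : ℝ) := by
    exact_mod_cast (show 1 ≤ t + s * s by nlinarith)
  refine ⟨((t + s * s : ℕ) : ℝ), by linarith, ?_⟩
  intro n γ _ hJ hG hM
  have hcount := kst_count s t n hs1 (fun u v => u ≠ v ∧ Touches (γ u) (γ v)) (by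
    intro a ha
    by_contra hcon
    have := ht n γ hJ hG hM a ha
      (Finset.univ.filter (fun v => ∀ i, a i ≠ v ∧ Touches (γ (a i)) (γ v))) (by omega)
      (fun i b hb => (Finset.mem_filter.1 hb).2 i)
    omega)
  have hT : touchingPairs γ ≤ ∑ v, (Finset.univ.filter
      (fun w => w ≠ v ∧ Touches (γ w) (γ v))).card := by
    have e : ∑ v, (Finset.univ.filter (fun w => w ≠ v ∧ Touches (γ w) (γ v))).card
        = (Finset.univ.filter (fun p : Fin n × Fin n =>
            p.1 ≠ p.2 ∧ Touches (γ p.1) (γ p.2))).card := by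
      simp_rw [Finset.card_filter]
      rw [Fintype.sum_prod_type_right]
    rw [e, ← Set.ncard_coe_finset]
    refine Set.ncard_le_ncard ?_ (Finset.finite_toSet _)
    intro p hp
    simp only [Finset.coe_filter, Finset.mem_univ, true_and, Set.mem_setOf_eq]
    exact ⟨ne_of_lt hp.1, hp.2⟩
  have hpow : (touchingPairs γ : ℝ) ^ s ≤ ((t + s * s : ℕ) : ℝ) * (n : ℝ) ^ (2 * s - 1) := by
    exact_mod_cast (Nat.pow_le_pow_left hT s).trans hcount
  rw [hsR]
  have hn0 : (0 : ℝ) ≤ (n : ℝ) := Nat.cast_nonneg n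
  have hexp : ((n : ℝ) ^ ((2 : ℝ) - 1 / (s : ℝ))) ^ s = (n : ℝ) ^ (2 * s - 1) := by
    rw [← Real.rpow_natCast, ← Real.rpow_mul hn0, ← Real.rpow_natCast]
    congr 1
    rw [Nat.cast_sub (by omega)]
    push_cast
    field_simp
  have hnn : (0 : ℝ) ≤ ((t + s * s : ℕ) : ℝ) * (n : ℝ) ^ ((2 : ℝ) - 1 / (s : ℝ)) :=
    mul_nonneg (by linarith) (Real.rpow_nonneg hn0 _)
  refine le_of_pow_le_pow_left₀ (n := s) (by omega) hnn (hpow.trans ?_)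
  rw [mul_pow, hexp]
  exact mul_le_mul_of_nonneg_right (le_self_pow₀ hK1 (by omega)) (pow_nonneg hn0 _)
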